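/- Let m > 0, r > 0 and ϑ ∈ (0, π/2), and set p = r cos ϑ, q = r sin ϑ. Then the linearization matrix satisfies A(p,q) = −(m/(2r²))·M(ϑ), where M(ϑ) is the 2×2 matrix with first row (sin 2ϑ, −1/sin²ϑ − cos 2ϑ) and second row (1/cos²ϑ − cos 2ϑ, −sin 2ϑ). Moreover M(ϑ) = dB/dϑ(ϑ), so that along any differentiable curve ϑ(t) with associated r(t) satisfying ϑ̇ = −m/(2r²), one has A(p(t), q(t)) = d/dt[B(ϑ(t))]. -/

import Mathlib

open MeasureTheory Metric Real Filter Topology Set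

noncomputable section

/-- The linearization matrix `A(p,q)` of the point-vortex system. -/
def Apv (m p q : ℝ) : Matrix (Fin 2) (Fin 2) ℝ :=
  (m / 2) • !![-2 * p * q / (p ^ 2 + q ^ 2) ^ 2,
               1 / q ^ 2 + (p ^ 2 - q ^ 2) / (p ^ 2 + q ^ 2) ^ 2;
               -1 / p ^ 2 + (p ^ 2 - q ^ 2) / (p ^ 2 + q ^ 2) ^ 2,
               2 * p * q / (p ^ 2 + q ^ 2) ^ 2]

/-- The matrix `B(ϑ)`. -/
def Bmat (ϑ : ℝ) : Matrix (Fin 2) (Fin 2) ℝ :=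
  !![-(1 / 2) * Real.cos (2 * ϑ),
     Real.cos ϑ / Real.sin ϑ - (1 / 2) * Real.sin (2 * ϑ);
     Real.sin ϑ / Real.cos ϑ - (1 / 2) * Real.sin (2 * ϑ),
     (1 / 2) * Real.cos (2 * ϑ)]

/-- The matrix `M(ϑ)`. -/
def Mmat (ϑ : ℝ) : Matrix (Fin 2) (Fin 2) ℝ :=
  !![Real.sin (2 * ϑ), -1 / Real.sin ϑ ^ 2 - Real.cos (2 * ϑ);
     1 / Real.cos ϑ ^ 2 - Real.cos (2 * ϑ), -Real.sin (2 * ϑ)]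

theorem Apv_polar (m : ℝ) {r ϑ : ℝ} (hr : r ≠ 0) (hs : Real.sin ϑ ≠ 0)
    (hc : Real.cos ϑ ≠ 0) :
    Apv m (r * Real.cos ϑ) (r * Real.sin ϑ) = (-(m / (2 * r ^ 2))) • Mmat ϑ := by
  have hsq : (r * Real.cos ϑ) ^ 2 + (r * Real.sin ϑ) ^ 2 = r ^ 2 := by
    linear_combination r ^ 2 * Real.cos_sq_add_sin_sq ϑ
  have h2 : Real.cos (2 * ϑ) = Real.cos ϑ ^ 2 - Real.sin ϑ ^ 2 := Real.cos_two_mul' ϑ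
  unfold Apv Mmat
  rw [hsq, h2, Real.sin_two_mul]
  ext i j
  fin_cases i <;> fin_cases j <;> simp <;> field_simp <;> ring

theorem hasDerivAt_Bmat {ϑ : ℝ} (hs : Real.sin ϑ ≠ 0) (hc : Real.cos ϑ ≠ 0) (i j : Fin 2) :
    HasDerivAt (fun θ : ℝ => Bmat θ i j) (Mmat ϑ i j) ϑ := by
  have hlin : HasDerivAt (fun θ : ℝ => 2 * θ) 2 ϑ := by
    simpa using (hasDerivAt_id ϑ).const_mul 2
  have h1 := Real.sin_sq_add_cos_sq ϑ
  fin_cases i <;> fin_cases j <;> simp only [Bmat, Mmat, Matrix.of_apply, Matrix.cons_val',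
    Matrix.cons_val_zero, Matrix.cons_val_one, Matrix.cons_val_fin_one, Fin.zero_eta, Fin.mk_one]
  · refine (hlin.cos.const_mul (-(1 / 2))).congr_deriv ?_
    ring
  · refine (((Real.hasDerivAt_cos ϑ).div (Real.hasDerivAt_sin ϑ) hs).sub
      (hlin.sin.const_mul (1 / 2))).congr_deriv ?_
    field_simp
    linear_combination -h1
  · refine (((Real.hasDerivAt_sin ϑ).div (Real.hasDerivAt_cos ϑ) hc).sub
      (hlin.sin.const_mul (1 / 2))).congr_deriv ?_
    field_simp
    linear_combination h1
  · refine (hlin.cos.const_mul (1 / 2)).congr_deriv ?_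
    ring

/-- `A(p,q) = −(m/(2r²))·M(ϑ)` when `p = r cos ϑ, q = r sin ϑ`; moreover
`M(ϑ) = dB/dϑ`, so along any differentiable curve `ϑ(t)` with associated `r(t)` and
`ϑ̇ = −m/(2r²)`, one has `A(p(t),q(t)) = d/dt[B(ϑ(t))]` (entrywise derivatives). -/
theorem statement_8 (m r ϑ : ℝ) (hm : 0 < m) (hr : 0 < r)
    (hϑ : ϑ ∈ Ioo (0:ℝ) (π / 2)) :
    Apv m (r * Real.cos ϑ) (r * Real.sin ϑ) = (-(m / (2 * r ^ 2))) • Mmat ϑ ∧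
    (∀ i j : Fin 2, HasDerivAt (fun θ : ℝ => Bmat θ i j) (Mmat ϑ i j) ϑ) ∧
    (∀ (ϑf rf : ℝ → ℝ) (t : ℝ), ϑf t ∈ Ioo (0:ℝ) (π / 2) → 0 < rf t →
      HasDerivAt ϑf (-(m / (2 * rf t ^ 2))) t →
      ∀ i j : Fin 2,
        HasDerivAt (fun τ : ℝ => Bmat (ϑf τ) i j)
          (Apv m (rf t * Real.cos (ϑf t)) (rf t * Real.sin (ϑf t)) i j) t) := by
  have trig : ∀ {x : ℝ}, x ∈ Ioo (0:ℝ) (π / 2) → Real.sin x ≠ 0 ∧ Real.cos x ≠ 0 := fun hx =>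
    ⟨(Real.sin_pos_of_pos_of_lt_pi hx.1 (by linarith [hx.2, Real.pi_pos])).ne',
      (Real.cos_pos_of_mem_Ioo ⟨by linarith [hx.1, Real.pi_pos], hx.2⟩).ne'⟩
  refine ⟨Apv_polar m hr.ne' (trig hϑ).1 (trig hϑ).2,
    hasDerivAt_Bmat (trig hϑ).1 (trig hϑ).2, ?_⟩
  intro ϑf rf t ht hrt hd i j
  obtain ⟨hs, hc⟩ := trig ht
  rw [Apv_polar m hrt.ne' hs hc, Matrix.smul_apply, smul_eq_mul, mul_comm]
  exact (hasDerivAt_Bmat hs hc i j).comp t hd
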